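/- The limiting partition is equitable: letting N = |V| (the number of vertices of G), whenever two vertices v and w are C_N-related, for every vertex u the number of neighbors of v that are C_N-related to u equals the number of neighbors of w that are C_N-related to u. (The paper's Theorem, equitable-partition part: the stable coloring is an equitable partition.) -/

import Mathlib

/-- Iterated color-refinement relation: `colRel V G 0` relates all pairs;
`colRel V G (n+1)` relates `v` and `w` iff for every vertex `u`, the number of
neighbors of `v` that are `colRel V G n`-related to `u` equals the number of
neighbors of `w` that are `colRel V G n`-related to `u`. -/
def colRel (V : Type*) (G : SimpleGraph V) : ℕ → V → V → Prop
  | 0 => fun _ _ => True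
  | n + 1 => fun v w => ∀ u : V,
      {x | G.Adj v x ∧ colRel V G n x u}.ncard =
      {x | G.Adj w x ∧ colRel V G n x u}.ncard

/-- `numClasses V G n` is the number of `colRel V G n`-equivalence classes. -/
noncomputable def numClasses (V : Type*) (G : SimpleGraph V) (n : ℕ) : ℕ :=
  {s : Set V | ∃ v : V, s = {w | colRel V G n v w}}.ncard

theorem colRel_equiv (V : Type*) (G : SimpleGraph V) (n : ℕ) :
    Equivalence (colRel V G n) := by
  cases n with
  | zero => exact ⟨fun _ => trivial, fun _ => trivial, fun _ _ => trivial⟩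
  | succ n =>
    exact ⟨fun _ _ => rfl, fun h u => (h u).symm, fun h k u => (h u).trans (k u)⟩

def colSetoid (V : Type*) (G : SimpleGraph V) (n : ℕ) : Setoid V :=
  ⟨colRel V G n, colRel_equiv V G n⟩

open Classical in
theorem colRel_count (V : Type*) [Fintype V] (G : SimpleGraph V) (n m : ℕ)
    (hr : ∀ x y, colRel V G m x y → colRel V G n x y) (v u : V) :
    {x | G.Adj v x ∧ colRel V G n x u}.ncard =
      ∑ q : Quotient (colSetoid V G m), if colRel V G n q.out u then
        {x | G.Adj v x ∧ colRel V G m x q.out}.ncard else 0 := by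
  have key : ∀ p : V → Prop, {x | p x}.ncard = (Finset.univ.filter p).card := by
    intro p
    rw [← Set.ncard_coe_finset]
    simp
  simp only [key]
  rw [Finset.card_eq_sum_card_fiberwise (t := Finset.univ)
    (f := fun x => (Quotient.mk (colSetoid V G m) x)) (fun _ _ => by simp)]
  refine Finset.sum_congr rfl fun q _ => ?_
  have hq : ∀ x, Quotient.mk (colSetoid V G m) x = q ↔ colRel V G m x q.out := by
    intro x
    conv_lhs => rw [← Quotient.out_eq q]
    exact Quotient.eq
  split_ifs with h
  · congr 1
    ext x
    simp only [Finset.mem_filter, Finset.mem_univ, true_and, hq]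
    exact ⟨fun k => ⟨k.1.1, k.2⟩,
      fun k => ⟨⟨k.1, (colRel_equiv V G n).trans (hr _ _ k.2) h⟩, k.2⟩⟩
  · rw [Finset.card_eq_zero, Finset.filter_eq_empty_iff]
    intro x hx k
    rw [hq] at k
    simp only [Finset.mem_filter, Finset.mem_univ, true_and] at hx
    exact h ((colRel_equiv V G n).trans ((colRel_equiv V G n).symm (hr _ _ k)) hx.2)

theorem colRel_step (V : Type*) [Fintype V] (G : SimpleGraph V) (n m : ℕ)
    (hr : ∀ x y, colRel V G m x y → colRel V G n x y) (x y : V)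
    (h : colRel V G (m + 1) x y) : colRel V G (n + 1) x y := by
  intro u
  rw [colRel_count V G n m hr, colRel_count V G n m hr]
  refine Finset.sum_congr rfl fun q _ => ?_
  rw [h q.out]

theorem colRel_mono (V : Type*) [Fintype V] (G : SimpleGraph V) (n : ℕ) :
    ∀ x y, colRel V G (n + 1) x y → colRel V G n x y := by
  induction n with
  | zero => exact fun _ _ _ => trivial
  | succ n ih => exact colRel_step V G n (n + 1) ih

theorem colRel_dich (V : Type*) [Fintype V] [Nonempty V] (G : SimpleGraph V) (n : ℕ) :
    (∀ x y, colRel V G n x y → colRel V G (n + 1) x y) ∨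
      n + 1 ≤ Nat.card (Quotient (colSetoid V G n)) := by
  induction n with
  | zero =>
    have : Nonempty (Quotient (colSetoid V G 0)) :=
      ⟨Quotient.mk _ (Classical.arbitrary V)⟩
    exact Or.inr Nat.card_pos
  | succ n ih =>
    by_cases hs : ∀ x y, colRel V G n x y → colRel V G (n + 1) x y
    · exact Or.inl (colRel_step V G (n + 1) n hs)
    · right
      have hc := ih.resolve_left hs
      by_contra hlt
      apply hs
      let f : Quotient (colSetoid V G (n + 1)) → Quotient (colSetoid V G n) :=
        Quotient.map id (colRel_mono V G n)
      have hf : Function.Surjective f := by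
        intro q
        induction q using Quotient.inductionOn with
        | h a => exact ⟨Quotient.mk _ a, rfl⟩
      have hle := Nat.card_le_card_of_surjective f hf
      have hb : Function.Bijective f :=
        (Nat.bijective_iff_surjective_and_card f).2 ⟨hf, by omega⟩
      intro x y hxy
      have : f (Quotient.mk _ x) = f (Quotient.mk _ y) :=
        Quotient.sound (s := colSetoid V G n) hxy
      exact Quotient.exact (hb.1 this)

/-- Theorem (equitable-partition part): the limiting partition is equitable. -/
theorem colRel_limit_equitable (V : Type*) [Fintype V] (G : SimpleGraph V)
    (v w : V) (h : colRel V G (Fintype.card V) v w) :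
    ∀ u : V,
      {x | G.Adj v x ∧ colRel V G (Fintype.card V) x u}.ncard =
      {x | G.Adj w x ∧ colRel V G (Fintype.card V) x u}.ncard := by
  haveI : Nonempty V := ⟨v⟩
  rcases colRel_dich V G (Fintype.card V) with hs | hc
  · exact hs v w h
  · have := Nat.card_le_card_of_surjective
      (Quotient.mk (colSetoid V G (Fintype.card V))) Quotient.mk_surjective
    rw [Nat.card_eq_fintype_card (α := V)] at this
    omega
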